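/- Let n ≥ 3 and let H be the cycle graph C_n on ZMod n. For every i ∈ ZMod n let G_i be a connected finite simple graph with property (P) on vertex set V_i, and let a_i be an attachment function assigning to each neighbor j of i in H a vertex a_i(j) ∈ V_i. Suppose there exist two consecutive vertices j and j+1 of the cycle such that a_j is a constant function and a_{j+1} is a constant function (i.e., G_j and G_{j+1} each attach to both of their cycle neighbors through a single bail vertex). Then the generalized threaded union of the family {G_i} over H with attachment functions {a_i} has property (P). -/

import Mathlib

open Matrix SimpleGraph

/-- A finite simple graph `G` has property (P) if there is a real symmetric matrix `A`
whose off-diagonal support is exactly the edge set of `G`, with `det A ≠ 0`, and such that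
every principal submatrix obtained by deleting one row/column is singular. -/
def HasPropertyP {V : Type*} [Finite V] (G : SimpleGraph V) : Prop :=
  letI : Fintype V := Fintype.ofFinite V
  letI : DecidableEq V := Classical.decEq V
  ∃ A : Matrix V V ℝ, A.IsSymm ∧
    (∀ u v : V, u ≠ v → (A u v ≠ 0 ↔ G.Adj u v)) ∧
    A.det ≠ 0 ∧
    ∀ v : V,
      (A.submatrix (fun x : {x : V // x ≠ v} => (x : V))
        (fun x : {x : V // x ≠ v} => (x : V))).det = 0


/-- The generalized threaded union of the family of graphs `G i` over `H`, with
attachment functions `a i : ι → V i`: vertices `⟨i, x⟩` and `⟨j, y⟩` are adjacent iff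
either `i = j` and `x, y` are adjacent in `G i`, or `i ≠ j`, `i` and `j` are adjacent
in `H`, `x = a i j` and `y = a j i`. -/
def genThreadedUnion {ι : Type*} (H : SimpleGraph ι) {V : ι → Type*}
    (G : ∀ i, SimpleGraph (V i)) (a : ∀ i, ι → V i) : SimpleGraph (Σ i, V i) :=
  SimpleGraph.fromRel fun x y =>
    (∃ (i : ι) (u v : V i), (G i).Adj u v ∧ x = ⟨i, u⟩ ∧ y = ⟨i, v⟩) ∨
    (x.1 ≠ y.1 ∧ H.Adj x.1 y.1 ∧ x.2 = a x.1 y.1 ∧ y.2 = a y.1 x.1)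

/-- The cycle graph on `ZMod n`: `i` and `j` are adjacent iff `j = i + 1` or `i = j + 1`. -/
def cycleG (n : ℕ) : SimpleGraph (ZMod n) :=
  SimpleGraph.fromRel fun i j => j = i + 1

lemma propP_iff_aux {V : Type*} [Fintype V] [DecidableEq V] (A N : Matrix V V ℝ)
    (h : A * N = 1) (v : V) :
    (A.submatrix (fun x : {x : V // x ≠ v} => (x : V))
        (fun x : {x : V // x ≠ v} => (x : V))).det = 0 ↔ N v v = 0 := by
  have h' : N * A = 1 := mul_eq_one_comm.mp h
  have key : ∀ (f : V → ℝ), f v = 0 → ∀ x : {x : V // x ≠ v},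
      (A.submatrix (fun x : {x : V // x ≠ v} => (x : V))
        (fun x : {x : V // x ≠ v} => (x : V)) *ᵥ (fun y => f y)) x = (A *ᵥ f) x := by
    intro f hf x
    simp only [Matrix.mulVec, dotProduct, Matrix.submatrix_apply]
    rw [← Fintype.sum_subtype_add_sum_subtype (fun y => y ≠ v) (fun y => A x y * f y)]
    rw [left_eq_add]
    apply Finset.sum_eq_zero
    rintro ⟨y, hy⟩ _
    have : y = v := not_not.mp hy
    subst this
    simp [hf]
  rw [← Matrix.exists_mulVec_eq_zero_iff]
  constructor
  · rintro ⟨z, hz, hz0⟩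
    let f : V → ℝ := fun y => if hy : y ≠ v then z ⟨y, hy⟩ else 0
    have hfv : f v = 0 := by simp [f]
    have hfz : (fun y : {x : V // x ≠ v} => f y) = z := by
      funext y
      have := y.2
      simp [f, this]
    have hk := key f hfv
    rw [hfz, hz0] at hk
    have hAf : A *ᵥ f = Pi.single v ((A *ᵥ f) v) := by
      funext x
      by_cases hx : x = v
      · subst hx; simp
      · rw [← hk ⟨x, hx⟩]; simp [hx]
    have hf : f = N *ᵥ Pi.single v ((A *ᵥ f) v) := by
      rw [← hAf, Matrix.mulVec_mulVec, h', Matrix.one_mulVec]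
    have hf0 : N v v * (A *ᵥ f) v = 0 := by
      have := congrFun hf v
      rw [hfv] at this
      simpa using this.symm
    rcases mul_eq_zero.mp hf0 with h0 | h0
    · exact h0
    · exfalso
      rw [h0] at hf
      apply hz
      rw [← hfz, hf]
      funext y
      simp
  · intro hN
    have hA : A *ᵥ (fun y => N y v) = Pi.single v 1 := by
      funext x
      have := congrFun (congrFun h x) v
      rw [Matrix.mul_apply] at this
      simp only [Matrix.mulVec, dotProduct]
      rw [this, Matrix.one_apply, Pi.single_apply]
    have hk := key (fun y => N y v) hN
    refine ⟨fun y => N y v, ?_, ?_⟩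
    · intro h0
      have : (fun y => N y v) = 0 := by
        funext y
        by_cases hy : y = v
        · subst hy; exact hN
        · exact congrFun h0 ⟨y, hy⟩
      rw [this] at hA
      have := congrFun hA v
      simp at this
    · funext x
      rw [hk x, hA]
      simp [x.2]

lemma edge_add {W : Type*} [Fintype W] [DecidableEq W] (M N : Matrix W W ℝ) (w u : W)
    (hMN : M * N = 1) (hN : N.IsSymm) (hww : N w w = 0) (huu : N u u = 0) (hwu : N w u = 0) :
    (M + (Matrix.single w u 1 + Matrix.single u w 1)) *
      (N - Matrix.of fun x y => N x w * N u y + N x u * N w y) = 1 := by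
  have huw : N u w = 0 := by rw [← hN.apply]; exact hwu
  have e : (Matrix.of fun x y => N x w * N u y + N x u * N w y)
      = N * (Matrix.single w u 1 + Matrix.single u w 1) * N := by
    ext x y
    simp [Matrix.mul_add, Matrix.mul_apply, Matrix.single_apply, ite_and, _root_.add_mul,
      Finset.sum_add_distrib]
  have z : (Matrix.single w u (1:ℝ) + Matrix.single u w 1) * N * (Matrix.single w u 1 + Matrix.single u w 1) = 0 := by
    simp [Matrix.mul_add, Matrix.add_mul, Matrix.single_mul_mul_single, hww, huu, hwu, huw]
  rw [e]
  generalize (Matrix.single w u (1:ℝ) + Matrix.single u w 1) = E at *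
  have : (M + E) * (N - N * E * N) = M * N - (M * N) * E * N + E * N - E * N * E * N := by
    noncomm_ring
  rw [this, hMN, z]
  simp

lemma edge_pat {W : Type*} [Fintype W] [DecidableEq W] (M : Matrix W W ℝ) (w u : W)
    (hM : M.IsSymm) (h0 : M w u = 0) (hne : w ≠ u) (x y : W) :
    (M + (Matrix.single w u (1:ℝ) + Matrix.single u w (1:ℝ)) : Matrix W W ℝ) x y ≠ 0 ↔
      M x y ≠ 0 ∨ ((x = w ∧ y = u) ∨ (y = w ∧ x = u)) := by
  have h1 : M u w = 0 := by rw [hM.apply]; exact h0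
  simp only [Matrix.add_apply, Matrix.single_apply]
  by_cases a : x = w ∧ y = u
  · obtain ⟨rfl, rfl⟩ := a
    simp [h0, hne]
  · by_cases b : y = w ∧ x = u
    · obtain ⟨rfl, rfl⟩ := b
      simp [h1, hne.symm]
    · have a' : ¬ (w = x ∧ u = y) := fun h => a ⟨h.1.symm, h.2.symm⟩
      have b' : ¬ (u = x ∧ w = y) := fun h => b ⟨h.2.symm, h.1.symm⟩
      simp [a, b, a', b']

lemma edge_symm {W : Type*} [Fintype W] [DecidableEq W] (M : Matrix W W ℝ) (w u : W)
    (hM : M.IsSymm) : (M + (Matrix.single w u 1 + Matrix.single u w 1)).IsSymm := by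
  unfold Matrix.IsSymm
  rw [Matrix.transpose_add, Matrix.transpose_add, hM.eq, Matrix.transpose_single,
    Matrix.transpose_single, add_comm (Matrix.single u w (1:ℝ))]

lemma edge_diag {W : Type*} [Fintype W] [DecidableEq W] (N : Matrix W W ℝ) (w u : W)
    (hN : N.IsSymm) (hd : ∀ x, N x x = 0) (hprod : ∀ x, N x w * N x u = 0) (x : W) :
    (N - Matrix.of fun x y => N x w * N u y + N x u * N w y) x x = 0 := by
  have := hprod x
  simp only [Matrix.sub_apply, Matrix.of_apply, hd]
  rw [hN.apply x w, hN.apply x u]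
  linarith

lemma chain {W : Type*} [Fintype W] [DecidableEq W] (m : ℕ) (hm : 2 ≤ m)
    (pos : W → ℕ) (w u : ℕ → W)
    (hw : ∀ l ≤ m, pos (w l) = l) (hu : ∀ l ≤ m, pos (u l) = l)
    (hq : w 0 = u (m+1)) (hp : w m = u m)
    (K B : Matrix W W ℝ) (hK : K.IsSymm) (hB : B.IsSymm) (hKB : K * B = 1)
    (hKp : ∀ x y, pos x ≠ pos y → K x y = 0) (hBp : ∀ x y, pos x ≠ pos y → B x y = 0)
    (hBd : ∀ x, B x x = 0) :
    ∃ M N : Matrix W W ℝ, M.IsSymm ∧ M * N = 1 ∧ (∀ x, N x x = 0) ∧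
      ∀ x y, (M x y ≠ 0 ↔ K x y ≠ 0 ∨
        ∃ l ≤ m, (x = w l ∧ y = u (l+1)) ∨ (y = w l ∧ x = u (l+1))) := by
  have step : ∀ k ≤ m, ∃ M N : Matrix W W ℝ, M.IsSymm ∧ N.IsSymm ∧ M * N = 1 ∧
      (∀ x, N x x = 0) ∧
      (∀ x y, (M x y ≠ 0 ↔ K x y ≠ 0 ∨
        ∃ l < k, (x = w l ∧ y = u (l+1)) ∨ (y = w l ∧ x = u (l+1)))) ∧
      (∀ x y, N x y ≠ 0 → pos x = pos y ∨ (pos x ≤ k ∧ pos y ≤ k)) ∧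
      (∀ y, pos y ≠ 0 → N (w 0) y = 0) ∧ (∀ y, pos y ≠ m → N (u m) y = 0) := by
    intro k
    induction k with
    | zero =>
      intro _
      refine ⟨K, B, hK, hB, hKB, hBd, by simp, ?_, ?_, ?_⟩
      · intro x y h
        left
        by_contra h'
        exact h (hBp _ _ h')
      · intro y hy
        apply hBp
        rw [hw 0 (by omega)]
        exact hy.symm
      · intro y hy
        apply hBp
        rw [hu m le_rfl]
        exact hy.symm
    | succ k ih =>
      intro hk
      obtain ⟨M, N, hM, hN, hMN, hd, hpat, hsup, hq0, hp0⟩ := ih (by omega)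
      have pw := hw k (by omega)
      have pu := hu (k+1) hk
      have hxu : ∀ x, N x (u (k+1)) ≠ 0 → pos x = k+1 := by
        intro x hx
        have := hsup _ _ hx
        omega
      have hxw : ∀ x, N x (w k) ≠ 0 → pos x ≤ k := by
        intro x hx
        have := hsup _ _ hx
        omega
      have hwu : N (w k) (u (k+1)) = 0 := by
        by_contra h
        have := hxu _ h
        omega
      have hprod : ∀ x, N x (w k) * N x (u (k+1)) = 0 := by
        intro x
        by_contra h
        have h1 := hxw x (left_ne_zero_of_mul h)
        have h2 := hxu x (right_ne_zero_of_mul h)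
        omega
      have hMwu : M (w k) (u (k+1)) = 0 := by
        by_contra h
        rcases (hpat _ _).mp h with h | ⟨l, hl, ⟨h1, h2⟩ | ⟨h1, h2⟩⟩
        · exact h (hKp _ _ (by omega))
        · have := hw l (by omega)
          rw [← h1] at this
          omega
        · have := hw l (by omega)
          rw [← h1] at this
          omega
      have hwune : w k ≠ u (k+1) := by
        intro h; rw [h] at pw; omega
      refine ⟨_, _, ?_, ?_, edge_add M N (w k) (u (k+1)) hMN hN (hd _) (hd _) hwu, ?_, ?_, ?_,
        ?_, ?_⟩
      · exact edge_symm _ _ _ hM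
      · ext x y
        simp only [Matrix.transpose_apply, Matrix.sub_apply, Matrix.of_apply]
        rw [hN.apply x y, hN.apply (w k) y, hN.apply (u (k+1)) y, hN.apply x (u (k+1)),
          hN.apply x (w k)]
        ring
      · exact edge_diag _ _ _ hN hd hprod
      · intro x y
        rw [edge_pat _ _ _ hM hMwu hwune, hpat, or_assoc]
        apply or_congr Iff.rfl
        constructor
        · rintro (⟨l, hl, h⟩ | h)
          · exact ⟨l, by omega, h⟩
          · exact ⟨k, by omega, h⟩
        · rintro ⟨l, hl, h⟩
          rcases Nat.lt_succ_iff_lt_or_eq.mp hl with h' | rfl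
          · exact Or.inl ⟨l, h', h⟩
          · exact Or.inr h
      · intro x y h
        by_contra hcon
        apply h
        simp only [Matrix.sub_apply, Matrix.of_apply]
        have e1 : N x y = 0 := by
          by_contra h1
          have := hsup _ _ h1
          omega
        have e2 : N x (w k) * N (u (k+1)) y = 0 := by
          by_contra h1
          have h2 := hxw _ (left_ne_zero_of_mul h1)
          have h3 := right_ne_zero_of_mul h1
          rw [← hN.apply] at h3
          have h4 := hxu _ h3
          omega
        have e3 : N x (u (k+1)) * N (w k) y = 0 := by
          by_contra h1
          have h2 := hxu _ (left_ne_zero_of_mul h1)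
          have h3 := right_ne_zero_of_mul h1
          rw [← hN.apply] at h3
          have h4 := hxw _ h3
          omega
        rw [e1, e2, e3]; simp
      · intro y hy
        simp only [Matrix.sub_apply, Matrix.of_apply]
        have e2 : N (w 0) (w k) = 0 := by
          rcases Nat.eq_zero_or_pos k with rfl | hk0
          · exact hd _
          · exact hq0 _ (by omega)
        rw [hq0 y hy, e2, hq0 (u (k+1)) (by omega)]
        simp
      · intro y hy
        simp only [Matrix.sub_apply, Matrix.of_apply]
        have e2 : N (u m) (u (k+1)) = 0 := by
          rcases Nat.eq_or_lt_of_le hk with h | h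
          · rw [h]; exact hd _
          · exact hp0 _ (by omega)
        rw [hp0 y hy, e2, hp0 (w k) (by omega)]
        simp
  obtain ⟨M, N, hM, hN, hMN, hd, hpat, hsup, hq0, hp0⟩ := step m le_rfl
  have pw := hw m le_rfl
  have pu : pos (u (m+1)) = 0 := by rw [← hq]; exact hw 0 (by omega)
  have hwu : N (w m) (u (m+1)) = 0 := by
    rw [hp]; exact hp0 _ (by omega)
  have hprod : ∀ x, N x (w m) * N x (u (m+1)) = 0 := by
    intro x
    rw [hp, ← hq, ← hN.apply x, ← hN.apply x (w 0)]
    by_cases hx : pos x = 0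
    · rw [hp0 x (by omega)]; simp
    · rw [hq0 x hx]; simp
  have hMwu : M (w m) (u (m+1)) = 0 := by
    by_contra h
    rcases (hpat _ _).mp h with h | ⟨l, hl, ⟨h1, h2⟩ | ⟨h1, h2⟩⟩
    · exact h (hKp _ _ (by omega))
    · have := hw l (by omega)
      rw [← h1] at this
      omega
    · have := hw l (by omega)
      have h3 := hu (l+1) (by omega)
      rw [← h1] at this
      rw [← h2] at h3
      omega
  have hwune : w m ≠ u (m+1) := by
    intro h; rw [h] at pw; omega
  refine ⟨_, _, edge_symm _ _ _ hM, edge_add M N (w m) (u (m+1)) hMN hN (hd _) (hd _) hwu,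
    edge_diag _ _ _ hN hd hprod, ?_⟩
  intro x y
  rw [edge_pat _ _ _ hM hMwu hwune, hpat, or_assoc]
  apply or_congr Iff.rfl
  constructor
  · rintro (⟨l, hl, h⟩ | h)
    · exact ⟨l, by omega, h⟩
    · exact ⟨m, le_rfl, h⟩
  · rintro ⟨l, hl, h⟩
    rcases Nat.lt_or_eq_of_le hl with h' | rfl
    · exact Or.inl ⟨l, h', h⟩
    · exact Or.inr h

lemma hasP_iff {V : Type*} [i0 : Finite V] [i1 : Fintype V] [i2 : DecidableEq V] (G : SimpleGraph V) :
    HasPropertyP G ↔ ∃ A N : Matrix V V ℝ, A.IsSymm ∧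
      (∀ u v : V, u ≠ v → (A u v ≠ 0 ↔ G.Adj u v)) ∧ A * N = 1 ∧ ∀ v, N v v = 0 := by
  obtain rfl : i1 = Fintype.ofFinite V := Subsingleton.elim _ _
  obtain rfl : i2 = Classical.decEq V := Subsingleton.elim _ _
  letI : Fintype V := Fintype.ofFinite V
  letI : DecidableEq V := Classical.decEq V
  unfold HasPropertyP
  constructor
  · rintro ⟨A, hA, hp, hdet, hv⟩
    have h : A * A⁻¹ = 1 := Matrix.mul_nonsing_inv A (isUnit_iff_ne_zero.mpr hdet)
    exact ⟨A, A⁻¹, hA, hp, h, fun v => (propP_iff_aux A _ h v).mp (hv v)⟩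
  · rintro ⟨A, N, hA, hp, h, hv⟩
    refine ⟨A, hA, hp, ?_, fun v => (propP_iff_aux A _ h v).mpr (hv v)⟩
    intro h0
    have := congrArg Matrix.det h
    rw [Matrix.det_mul, h0] at this
    simp at this

/-- Let `H` be the cycle on `n ≥ 3` vertices and let each `G i` be a connected graph with
property (P).  If there are two consecutive vertices `j` and `j + 1` of the cycle whose
attachment functions are constant on their cycle neighbors (i.e. `G j` and `G (j+1)` each
attach through a single bail vertex), then the generalized threaded union of the `G i`
over `H` has property (P). -/
theorem stmt_19 (n : ℕ) (hn : 3 ≤ n) {V : ZMod n → Type*} [∀ i, Finite (V i)]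
    (G : ∀ i, SimpleGraph (V i))
    (hGconn : ∀ i, (G i).Connected) (hGP : ∀ i, HasPropertyP (G i))
    (a : ∀ i, ZMod n → V i) (j : ZMod n)
    (hj : ∀ i i' : ZMod n, (cycleG n).Adj j i → (cycleG n).Adj j i' → a j i = a j i')
    (hj1 : ∀ i i' : ZMod n, (cycleG n).Adj (j + 1) i → (cycleG n).Adj (j + 1) i' →
      a (j + 1) i = a (j + 1) i') :
    haveI : NeZero n := ⟨by omega⟩
    HasPropertyP (genThreadedUnion (cycleG n) G a) := by
  haveI : NeZero n := ⟨by omega⟩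
  haveI : Fact (1 < n) := ⟨by omega⟩
  classical
  haveI : ∀ i, Fintype (V i) := fun i => Fintype.ofFinite (V i)
  simp only [hasP_iff] at hGP
  choose A N hA hpat hAN hN0 using hGP
  have hNs : ∀ i, (N i).IsSymm := by
    intro i
    have h1 : N i = (A i)⁻¹ := (Matrix.inv_eq_right_inv (hAN i)).symm
    rw [h1]
    exact (hA i).inv
  rw [hasP_iff]
  have hadj : ∀ i k, (cycleG n).Adj i k ↔ k = i + 1 ∨ i = k + 1 := by
    intro i k
    simp only [cycleG, SimpleGraph.fromRel_adj]
    constructor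
    · exact fun h => h.2
    · intro h
      refine ⟨?_, h⟩
      rintro rfl
      simp at h
  obtain ⟨m, rfl⟩ : ∃ m, n = m + 1 := ⟨n - 1, by omega⟩
  have hcm : ((m : ℕ) : ZMod (m+1)) = -1 := by
    have : (((m + 1 : ℕ)) : ZMod (m+1)) = 0 := ZMod.natCast_self (m+1)
    push_cast at this
    exact eq_neg_of_add_eq_zero_left this
  let c : ℕ → ZMod (m+1) := fun l => j + 1 + (l : ZMod (m+1))
  have hcs : ∀ l, c (l+1) = c l + 1 := by
    intro l; simp only [c]; push_cast; ring
  let w : ℕ → Σ i, V i := fun l => ⟨c l, a (c l) (c l + 1)⟩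
  let u : ℕ → Σ i, V i := fun l => ⟨c l, a (c l) (c l - 1)⟩
  let pos : (Σ i, V i) → ℕ := fun x => (x.1 - (j + 1)).val
  have hposc : ∀ l ≤ m, (c l - (j + 1)).val = l := by
    intro l hl
    have : c l - (j + 1) = (l : ZMod (m+1)) := by simp only [c]; ring
    rw [this, ZMod.val_natCast_of_lt (by omega)]
  have hposne : ∀ x y : (Σ i, V i), pos x ≠ pos y → x.1 ≠ y.1 := by
    intro x y h h'
    apply h
    simp only [pos, h']
  have hK0 : ∀ (D : ∀ i, Matrix (V i) (V i) ℝ) (x y : Σ i, V i), x.1 ≠ y.1 →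
      Matrix.blockDiagonal' D x y = 0 := by
    rintro D ⟨i, x⟩ ⟨k, y⟩ h
    exact Matrix.blockDiagonal'_apply_ne _ _ _ h
  have hgen : ∀ (i i' : ZMod (m+1)), i = i' →
      (∀ k k', (cycleG (m+1)).Adj i' k → (cycleG (m+1)).Adj i' k' → a i' k = a i' k') →
      a i (i + 1) = a i (i - 1) := by
    rintro i _ rfl h
    apply h
    · rw [hadj]; simp
    · rw [hadj]; simp
  obtain ⟨M, N', hM, hMN, hd, hMp⟩ := chain m (by omega) pos w u
    (fun l hl => hposc l hl) (fun l hl => hposc l hl)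
    (by
      have h1 : c (m+1) = c 0 := by
        simp only [c]; push_cast; rw [hcm]; ring
      have h2 : c 0 = j + 1 := by simp [c]
      simp only [w, u]
      rw [h1, hgen (c 0) (j+1) h2 hj1])
    (by
      have h2 : c m = j := by simp only [c]; rw [hcm]; ring
      simp only [w, u]
      rw [hgen (c m) j h2 hj])
    (Matrix.blockDiagonal' A) (Matrix.blockDiagonal' N)
    (by
      unfold Matrix.IsSymm
      rw [Matrix.blockDiagonal'_transpose]
      congr 1; funext i; exact hA i)
    (by
      unfold Matrix.IsSymm
      rw [Matrix.blockDiagonal'_transpose]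
      congr 1; funext i; exact hNs i)
    (by
      rw [← Matrix.blockDiagonal'_mul]
      simp only [hAN]
      exact Matrix.blockDiagonal'_one)
    (fun x y h => hK0 _ _ _ (hposne _ _ h))
    (fun x y h => hK0 _ _ _ (hposne _ _ h))
    (by
      rintro ⟨i, x⟩
      rw [Matrix.blockDiagonal'_apply_eq]
      exact hN0 i x)
  refine ⟨M, N', hM, ?_, hMN, hd⟩
  have hcsurj : ∀ i : ZMod (m+1), ∃ l ≤ m, c l = i := by
    intro i
    refine ⟨(i - (j+1)).val, ?_, ?_⟩
    · have := ZMod.val_lt (i - (j+1))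
      omega
    · simp only [c]
      rw [ZMod.natCast_zmod_val]; ring
  -- cross edges
  have hcross : ∀ x y : Σ i, V i, (y.1 = x.1 + 1 ∧ x.2 = a x.1 y.1 ∧ y.2 = a y.1 x.1) ↔
      ∃ l ≤ m, x = w l ∧ y = u (l+1) := by
    rintro ⟨i, x⟩ ⟨k, y⟩
    constructor
    · rintro ⟨h1, h2, h3⟩
      dsimp only at h1 h2 h3
      subst h1
      obtain ⟨l, hl, rfl⟩ := hcsurj i
      refine ⟨l, hl, ?_, ?_⟩
      · simp only [w, h2]
      · simp only [u]
        rw [hcs, h3]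
        simp
    · rintro ⟨l, hl, h1, h2⟩
      rw [h1, h2]
      simp only [w, u]
      rw [hcs]
      simp
  intro x y hxy
  rw [hMp]
  simp only [genThreadedUnion, SimpleGraph.fromRel_adj]
  have hexp : (∃ l ≤ m, (x = w l ∧ y = u (l+1)) ∨ (y = w l ∧ x = u (l+1))) ↔
      (x.1 ≠ y.1 ∧ (cycleG (m+1)).Adj x.1 y.1 ∧ x.2 = a x.1 y.1 ∧ y.2 = a y.1 x.1) := by
    have h1 := hcross x y
    have h2 := hcross y x
    have h3 : (cycleG (m+1)).Adj x.1 y.1 → x.1 ≠ y.1 := fun h => h.ne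
    have h4 := hadj x.1 y.1
    have h5 : (∃ l ≤ m, (x = w l ∧ y = u (l+1)) ∨ (y = w l ∧ x = u (l+1))) ↔
        (∃ l ≤ m, (x = w l ∧ y = u (l+1))) ∨ (∃ l ≤ m, (y = w l ∧ x = u (l+1))) := by
      constructor
      · rintro ⟨l, hl, h | h⟩
        · exact Or.inl ⟨l, hl, h⟩
        · exact Or.inr ⟨l, hl, h⟩
      · rintro (⟨l, hl, h⟩ | ⟨l, hl, h⟩)
        · exact ⟨l, hl, Or.inl h⟩
        · exact ⟨l, hl, Or.inr h⟩
    rw [h5, ← h1, ← h2]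
    constructor
    · rintro (⟨e1, e2, e3⟩ | ⟨e1, e2, e3⟩)
      · have e := h4.mpr (Or.inl e1)
        exact ⟨h3 e, e, e2, e3⟩
      · have e := h4.mpr (Or.inr e1)
        exact ⟨h3 e, e, e3, e2⟩
    · rintro ⟨_, e, e2, e3⟩
      rcases h4.mp e with e1 | e1
      · exact Or.inl ⟨e1, e2, e3⟩
      · exact Or.inr ⟨e1, e3, e2⟩
  have hin : ∀ x y : Σ i, V i, x ≠ y → (Matrix.blockDiagonal' A x y ≠ 0 ↔
      ∃ (i : ZMod (m+1)) (u v : V i), (G i).Adj u v ∧ x = ⟨i, u⟩ ∧ y = ⟨i, v⟩) := by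
    rintro ⟨i, x⟩ ⟨k, y⟩ hne
    constructor
    · intro h
      by_cases hik : i = k
      · subst hik
        rw [Matrix.blockDiagonal'_apply_eq, hpat i x y (by rintro rfl; exact hne rfl)] at h
        exact ⟨i, x, y, h, rfl, rfl⟩
      · exact absurd (hK0 A ⟨i, x⟩ ⟨k, y⟩ hik) h
    · rintro ⟨i', p, q, h, h1, h2⟩
      rw [h1, h2, Matrix.blockDiagonal'_apply_eq, hpat i' p q h.ne]
      exact h
  rw [hexp, hin x y hxy]
  constructor
  · exact fun h => ⟨hxy, Or.inl h⟩
  · rintro ⟨_, h | ⟨i, p, q, h, h1, h2⟩ | ⟨h1, h2, h3, h4⟩⟩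
    · exact h
    · exact Or.inl ⟨i, q, p, h.symm, h2, h1⟩
    · exact Or.inr ⟨h1.symm, h2.symm, h4, h3⟩
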